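/- Let Σ_A be a one-sided countable topological Markov shift, φ : Σ_A → ℝ a measurable potential, λ > 0, and m a σ-finite, σ-invariant, φ-DLR Borel measure. Then L_φ 1(x) = λ for m-a.e. x (i.e., Σ_{a : A(a,x_0)=1} e^{φ(ax)} = λ for m-a.e. x ∈ Σ_A) if and only if m is a (φ,λ)-conformal measure. -/

import Mathlib

open MeasureTheory Filter Topology ENNReal

namespace CMS

/-- A sequence is admissible for the transition matrix `A`. -/
def IsAdm (A : ℕ → ℕ → Bool) (u : ℕ → ℕ) : Prop := ∀ i, A (u i) (u (i + 1)) = true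

/-- The one-sided countable topological Markov shift. -/
abbrev Space (A : ℕ → ℕ → Bool) := {u : ℕ → ℕ // IsAdm A u}

/-- The transition matrix has no row and no column identically zero. -/
def NoDegenerate (A : ℕ → ℕ → Bool) : Prop :=
  (∀ i, ∃ j, A i j = true) ∧ (∀ j, ∃ i, A i j = true)

/-- The shift map. -/
def shift {A : ℕ → ℕ → Bool} (x : Space A) : Space A :=
  ⟨fun i => x.1 (i + 1), fun i => x.2 (i + 1)⟩

/-- Birkhoff (ergodic) sum `φ_n`. -/
noncomputable def birkhoff {A : ℕ → ℕ → Bool} (φ : Space A → ℝ) (n : ℕ) (x : Space A) : ℝ :=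
  ∑ i ∈ Finset.range n, φ (shift^[i] x)

/-- The cylinder set determined by a word. -/
def cyl (A : ℕ → ℕ → Bool) (w : List ℕ) : Set (Space A) :=
  {x | ∀ i : Fin w.length, x.1 i = w.get i}

/-- Concatenation of a finite word with a sequence. -/
def concatSeq (w : List ℕ) (u : ℕ → ℕ) : ℕ → ℕ :=
  fun i => if h : i < w.length then w.get ⟨i, h⟩ else u (i - w.length)

/-- Prepending a single symbol to a sequence. -/
def prependSeq (a : ℕ) (u : ℕ → ℕ) : ℕ → ℕ := fun i => Nat.casesOn i a u

/-- The set of points to which the symbol `a` may be prepended. -/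
def admits (A : ℕ → ℕ → Bool) (a : ℕ) : Set (Space A) := {x | A a (x.1 0) = true}

/-- Prepending a symbol to a point of the shift space (identity if not admissible). -/
noncomputable def prep (A : ℕ → ℕ → Bool) (a : ℕ) (x : Space A) : Space A :=
  if h : A a (x.1 0) = true then
    ⟨prependSeq a x.1, by
      intro i
      cases i with
      | zero => exact h
      | succ j => exact x.2 j⟩
  else x

/-- The measure `ν ⊚ σ`, `ν⊚σ(E) = Σ_a ν(σ(E ∩ [a]))`. -/
noncomputable def circ (A : ℕ → ℕ → Bool) (ν : Measure (Space A)) : Measure (Space A) :=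
  Measure.sum fun a : ℕ => (ν.restrict (admits A a)).map (prep A a)

/-- `ν` is `(φ, l)`-conformal: `dν/d(ν⊚σ) = l⁻¹ e^φ`. -/
def Conformal (A : ℕ → ℕ → Bool) (φ : Space A → ℝ) (l : ℝ) (ν : Measure (Space A)) : Prop :=
  ∀ E : Set (Space A), MeasurableSet E →
    ν E = ∫⁻ x in E, ENNReal.ofReal (l⁻¹ * Real.exp (φ x)) ∂(circ A ν)

/-- The Ruelle transfer operator. -/
noncomputable def ruelle (A : ℕ → ℕ → Bool) (φ f : Space A → ℝ) (x : Space A) : ℝ :=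
  ∑' a : ℕ, if A a (x.1 0) = true then Real.exp (φ (prep A a x)) * f (prep A a x) else 0

/-- The Ruelle operator applied to the constant function 1, valued in `ℝ≥0∞`. -/
noncomputable def ruelleOne (A : ℕ → ℕ → Bool) (φ : Space A → ℝ) (x : Space A) : ℝ≥0∞ :=
  ∑' a : ℕ, if A a (x.1 0) = true then ENNReal.ofReal (Real.exp (φ (prep A a x))) else 0

/-- `L*_φ ν = l ν` : the dual eigenmeasure equation. -/
def DualEigen (A : ℕ → ℕ → Bool) (φ : Space A → ℝ) (l : ℝ) (ν : Measure (Space A)) : Prop :=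
  ∀ f : Space A → ℝ, Integrable f ν →
    ∫ x, ruelle A φ f x ∂ν = l * ∫ x, f x ∂ν

/-- The sub-σ-algebra `σ^{-n} 𝓑`. -/
def shiftSigma (A : ℕ → ℕ → Bool) (n : ℕ) : MeasurableSpace (Space A) :=
  MeasurableSpace.comap (shift^[n]) inferInstance

/-- A sub-σ-algebra `m` is compatible with `ν`: the restriction of `ν` to `m` is σ-finite. -/
def Compatible (A : ℕ → ℕ → Bool) (ν : Measure (Space A))
    (m : MeasurableSpace (Space A)) : Prop :=
  ∃ s : ℕ → Set (Space A), (∀ k, MeasurableSet[m] (s k)) ∧ (∀ k, ν (s k) ≠ ⊤) ∧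
    (⋃ k, s k) = Set.univ

open Classical in
/-- Numerator of the DLR kernel: `e^{φ_n(w σ^n x)} 1{w σ^n x ∈ Σ_A}`. -/
noncomputable def dlrNum (A : ℕ → ℕ → Bool) (φ : Space A → ℝ) (w : List ℕ)
    (x : Space A) : ℝ :=
  if h : IsAdm A (concatSeq w ((shift^[w.length] x).1)) then
    Real.exp (birkhoff φ w.length (⟨concatSeq w ((shift^[w.length] x).1), h⟩ : Space A))
  else 0

/-- Denominator of the DLR kernel: `Σ_{y : σ^n y = σ^n x} e^{φ_n(y)}`. -/
noncomputable def dlrDen (A : ℕ → ℕ → Bool) (φ : Space A → ℝ) (n : ℕ) (x : Space A) : ℝ :=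
  ∑' y : {y : Space A // shift^[n] y = shift^[n] x}, Real.exp (birkhoff φ n y.1)

/-- `ν` is a `φ`-DLR measure. -/
def IsDLR (A : ℕ → ℕ → Bool) (φ : Space A → ℝ) (ν : Measure (Space A)) : Prop :=
  ∀ n : ℕ, 1 ≤ n →
    Compatible A ν (shiftSigma A n) ∧
    ∀ w : List ℕ, w.length = n →
      (ν[Set.indicator (cyl A w) (fun _ => (1 : ℝ))|shiftSigma A n])
        =ᵐ[ν] fun x => dlrNum A φ w x / dlrDen A φ n x

/-- `ν` is non-singular: `ν ∘ σ⁻¹ ∼ ν`. -/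
def NonSingular (A : ℕ → ℕ → Bool) (ν : Measure (Space A)) : Prop :=
  ν.map shift ≪ ν ∧ ν ≪ ν.map shift

/-- Conservative non-singular measure. -/
def Conservative (A : ℕ → ℕ → Bool) (ν : Measure (Space A)) : Prop :=
  NonSingular A ν ∧
    ∀ W : Set (Space A), MeasurableSet W →
      (∀ i j : ℕ, i ≠ j → ν ((shift^[i] ⁻¹' W) ∩ (shift^[j] ⁻¹' W)) = 0) → ν W = 0

/-- The `n`-th variation `Var_n φ`, valued in `ℝ≥0∞`. -/
noncomputable def varn (A : ℕ → ℕ → Bool) (φ : Space A → ℝ) (n : ℕ) : ℝ≥0∞ :=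
  ⨆ (x : Space A) (y : Space A) (_ : ∀ i, i < n → x.1 i = y.1 i),
    ENNReal.ofReal |φ x - φ y|

noncomputable def waltersBound (A : ℕ → ℕ → Bool) (φ : Space A → ℝ) (k : ℕ) : ℝ≥0∞ :=
  ⨆ (n : ℕ) (_ : 1 ≤ n), varn A (birkhoff φ n) (n + k)

/-- The Walters condition. -/
def Walters (A : ℕ → ℕ → Bool) (φ : Space A → ℝ) : Prop :=
  (∀ k, 1 ≤ k → waltersBound A φ k ≠ ⊤) ∧
  Tendsto (waltersBound A φ) atTop (nhds 0)

/-- `φ` is weakly Hölder continuous. -/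
def WeaklyHolder (A : ℕ → ℕ → Bool) (φ : Space A → ℝ) : Prop :=
  ∃ H θ : ℝ, 0 < H ∧ θ ∈ Set.Ioo (0 : ℝ) 1 ∧
    ∀ n : ℕ, 2 ≤ n → varn A φ n ≤ ENNReal.ofReal (H * θ ^ n)

/-- The partition function `Z_n(φ, a)`, valued in `ℝ≥0∞`. -/
noncomputable def Zn (A : ℕ → ℕ → Bool) (φ : Space A → ℝ) (n a : ℕ) : ℝ≥0∞ :=
  ∑' x : {x : Space A // shift^[n] x = x ∧ x.1 0 = a},
    ENNReal.ofReal (Real.exp (birkhoff φ n x.1))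

/-- The partition function `Z*_n(φ, a)` over periodic points whose first return to `[a]` is `n`. -/
noncomputable def Znstar (A : ℕ → ℕ → Bool) (φ : Space A → ℝ) (n a : ℕ) : ℝ≥0∞ :=
  ∑' x : {x : Space A // shift^[n] x = x ∧ x.1 0 = a ∧
      ∀ k, 0 < k → k < n → (shift^[k] x).1 0 ≠ a},
    ENNReal.ofReal (Real.exp (birkhoff φ n x.1))

/-- `P` is the (finite) Gurevich pressure of `φ`. -/
def HasGurevich (A : ℕ → ℕ → Bool) (φ : Space A → ℝ) (P : ℝ) : Prop :=
  ∀ a : ℕ, (cyl A [a]).Nonempty →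
    (∀ n, 1 ≤ n → Zn A φ n a ≠ ⊤) ∧
    Tendsto (fun n : ℕ => Real.log (Zn A φ n a).toReal / n) atTop (nhds P)

/-- `φ` is recurrent (with Gurevich pressure `P`). -/
def Recurrent (A : ℕ → ℕ → Bool) (φ : Space A → ℝ) (P : ℝ) : Prop :=
  ∀ a : ℕ, (cyl A [a]).Nonempty →
    ∑' n : ℕ, ENNReal.ofReal (Real.exp (-((n + 1 : ℕ) : ℝ) * P)) * Zn A φ (n + 1) a = ⊤

/-- `φ` is positive recurrent (with Gurevich pressure `P`). -/
def PosRecurrent (A : ℕ → ℕ → Bool) (φ : Space A → ℝ) (P : ℝ) : Prop :=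
  Recurrent A φ P ∧
  ∀ a : ℕ, (cyl A [a]).Nonempty →
    ∑' n : ℕ, ((n + 1 : ℕ) : ℝ≥0∞) *
      ENNReal.ofReal (Real.exp (-((n + 1 : ℕ) : ℝ) * P)) * Znstar A φ (n + 1) a ≠ ⊤

/-- `φ` is transient (with Gurevich pressure `P`). -/
def Transient (A : ℕ → ℕ → Bool) (φ : Space A → ℝ) (P : ℝ) : Prop :=
  ∀ a : ℕ, (cyl A [a]).Nonempty →
    ∑' n : ℕ, ENNReal.ofReal (Real.exp (-((n + 1 : ℕ) : ℝ) * P)) * Zn A φ (n + 1) a ≠ ⊤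

/-- `Σ_A` is topologically mixing. -/
def TopMixing (A : ℕ → ℕ → Bool) : Prop :=
  ∀ a b : ℕ, ∃ N : ℕ, ∀ n, N < n → ∃ x : Space A, x.1 0 = a ∧ (shift^[n] x).1 0 = b

/-- The big images and preimages (BIP) property. -/
def BIP (A : ℕ → ℕ → Bool) : Prop :=
  ∃ (N : ℕ) (b : Fin N → ℕ), ∀ a : ℕ,
    (∃ i, A (b i) a = true) ∧ (∃ j, A a (b j) = true)

/-- An admissible word. -/
def AdmWord (A : ℕ → ℕ → Bool) (w : List ℕ) : Prop :=
  ∀ (i : ℕ) (h : i + 1 < w.length),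
    A (w.get ⟨i, Nat.lt_of_succ_lt h⟩) (w.get ⟨i + 1, h⟩) = true

/-- The image of `E ⊆ [a̲]` under the cylinder-swapping map `v_{a̲,b̲}`. -/
def swapImage (A : ℕ → ℕ → Bool) (b : List ℕ) (E : Set (Space A)) : Set (Space A) :=
  {y | ∃ x ∈ E, y.1 = concatSeq b ((shift^[b.length] x).1)}

/-- The image of `E` under the prepending map `I_b`. -/
def prepImage (A : ℕ → ℕ → Bool) (b : ℕ) (E : Set (Space A)) : Set (Space A) :=
  {y | ∃ x ∈ E, y.1 = prependSeq b x.1}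

/-- The transition matrix of the renewal shift:
`A(1,1) = A(1,i) = A(i,i-1) = 1` (for `i > 1`), all other entries `0`. -/
def renA : ℕ → ℕ → Bool := fun i j => decide ((i = 1 ∧ 1 ≤ j) ∨ (2 ≤ i ∧ j = i - 1))

/-- The transition matrix of the shift `Σ_{𝓡⁻}`:
`A(i,i+1) = A(i,1) = 1` for `i ≥ 1`, all other entries `0`. -/
def rminusA : ℕ → ℕ → Bool := fun i j => decide (1 ≤ i ∧ (j = i + 1 ∨ j = 1))

/-- The periodic sequence obtained by repeating the word `w`. -/
def perSeq (w : List ℕ) : ℕ → ℕ := fun i => w.getD (i % w.length) 0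

/-- The word `(j, j-1, …, 1, n, n-1, …, j+1)`. -/
def gammaWord (j n : ℕ) : List ℕ :=
  ((List.range j).map (· + 1)).reverse ++ ((List.range (n - j)).map (· + (j + 1))).reverse

/-- The point `x̄ = (1, 2, 3, …)` of `Σ_{𝓡⁻}`. -/
def xbar : Space rminusA := ⟨fun i => i + 1, by intro i; simp [rminusA]⟩

section Shift

variable {A : ℕ → ℕ → Bool}

theorem measurable_coord (i : ℕ) : Measurable fun x : Space A => x.1 i :=
  (measurable_pi_apply i).comp measurable_subtype_coe

theorem measurable_shift : Measurable (shift : Space A → Space A) :=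
  Measurable.subtype_mk (measurable_pi_iff.2 fun i => measurable_coord (i + 1))

theorem measurableSet_admits (a : ℕ) : MeasurableSet (admits A a) :=
  measurable_coord 0 (MeasurableSet.of_discrete (s := {j | A a j = true}))

theorem prep_val_of_mem {a : ℕ} {x : Space A} (h : x ∈ admits A a) :
    (prep A a x).1 = prependSeq a x.1 := by
  have h' : A a (x.1 0) = true := h
  simp [prep, h']

theorem shift_prep {a : ℕ} {x : Space A} (h : x ∈ admits A a) : shift (prep A a x) = x := by
  apply Subtype.ext
  funext i
  change (prep A a x).1 (i + 1) = x.1 i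
  rw [prep_val_of_mem h]
  rfl

theorem shift_mem_admits (x : Space A) : shift x ∈ admits A (x.1 0) := x.2 0

theorem prep_shift (x : Space A) : prep A (x.1 0) (shift x) = x := by
  apply Subtype.ext
  rw [prep_val_of_mem (shift_mem_admits x)]
  funext i
  cases i <;> rfl

theorem measurable_prep (a : ℕ) : Measurable (prep A a) := by
  refine Measurable.subtype_mk (f := fun x => (prep A a x).1)
    (hf := measurable_pi_iff.2 fun i => ?_)
  classical
  have key : (fun x : Space A => (prep A a x).1 i) =
      fun x => if x ∈ admits A a then prependSeq a x.1 i else x.1 i := by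
    funext x
    split_ifs with h
    · rw [prep_val_of_mem h]
    · have h' : ¬ A a (x.1 0) = true := h
      simp [prep, h']
  rw [key]
  refine Measurable.ite (measurableSet_admits a) ?_ (measurable_coord i)
  cases i with
  | zero => exact measurable_const
  | succ j => exact measurable_coord j

theorem mem_cyl_singleton {a : ℕ} {x : Space A} : x ∈ cyl A [a] ↔ x.1 0 = a := by
  simp [cyl]

theorem measurableSet_cyl_singleton (a : ℕ) : MeasurableSet (cyl A [a]) := by
  have : cyl A [a] = (fun x : Space A => x.1 0) ⁻¹' {a} := by
    ext x
    exact mem_cyl_singleton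
  rw [this]
  exact measurable_coord 0 (measurableSet_singleton a)

theorem preimage_shift_preimage_prep_inter_cyl (a : ℕ) (E : Set (Space A)) :
    shift ⁻¹' (prep A a ⁻¹' E) ∩ cyl A [a] = E ∩ cyl A [a] := by
  ext x
  simp only [Set.mem_inter_iff, Set.mem_preimage, mem_cyl_singleton]
  refine and_congr_left ?_
  rintro rfl
  rw [prep_shift]

theorem shiftSigma_le (n : ℕ) : shiftSigma A n ≤ Subtype.instMeasurableSpace :=
  (measurable_shift.iterate n).comap_le

theorem Compatible.sigmaFinite_trim {ν : Measure (Space A)} {m : MeasurableSpace (Space A)}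
    (hm : m ≤ Subtype.instMeasurableSpace) (h : Compatible A ν m) :
    SigmaFinite (ν.trim hm) := by
  obtain ⟨s, hs, hfin, hU⟩ := h
  exact ⟨⟨⟨s, fun _ => trivial, fun k => by
    rw [trim_measurableSet_eq hm (hs k)]
    exact (hfin k).lt_top, hU⟩⟩⟩

end Shift

section Weight

variable {A : ℕ → ℕ → Bool} {φ : Space A → ℝ}

/-- The weight `e^{φ(ax)} 1{ax ∈ Σ_A}` of the branch `x ↦ ax`. -/
noncomputable def weight (A : ℕ → ℕ → Bool) (φ : Space A → ℝ) (a : ℕ) (x : Space A) : ℝ≥0∞ :=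
  if A a (x.1 0) = true then ENNReal.ofReal (Real.exp (φ (prep A a x))) else 0

theorem weight_of_mem {a : ℕ} {x : Space A} (h : x ∈ admits A a) :
    weight A φ a x = ENNReal.ofReal (Real.exp (φ (prep A a x))) := if_pos h

theorem weight_of_notMem {a : ℕ} {x : Space A} (h : x ∉ admits A a) :
    weight A φ a x = 0 := if_neg h

theorem weight_ne_top (a : ℕ) (x : Space A) : weight A φ a x ≠ ⊤ := by
  unfold weight
  split_ifs <;> simp

theorem measurable_weight (hφ : Measurable φ) (a : ℕ) : Measurable (weight A φ a) :=
  Measurable.ite (measurableSet_admits a)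
    (Real.measurable_exp.comp (hφ.comp (measurable_prep a))).ennreal_ofReal measurable_const

theorem setLIntegral_circ {ν : Measure (Space A)} {f : Space A → ℝ≥0∞} (hf : Measurable f)
    {E : Set (Space A)} (hE : MeasurableSet E) :
    ∫⁻ x in E, f x ∂(circ A ν) =
      ∑' a, ∫⁻ x in prep A a ⁻¹' E ∩ admits A a, f (prep A a x) ∂ν := by
  rw [circ, Measure.restrict_sum _ hE, lintegral_sum_measure]
  refine tsum_congr fun a => ?_
  rw [setLIntegral_map hE hf (measurable_prep a),
    Measure.restrict_restrict (measurable_prep a hE)]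

theorem conformal_iff (hφ : Measurable φ) {l : ℝ} (hl : 0 < l) {ν : Measure (Space A)} :
    Conformal A φ l ν ↔ ∀ E : Set (Space A), MeasurableSet E →
      ν E = ∑' a, ∫⁻ x in prep A a ⁻¹' E, ENNReal.ofReal l⁻¹ * weight A φ a x ∂ν := by
  refine forall₂_congr fun E hE => ?_
  rw [setLIntegral_circ (by fun_prop) hE]
  refine Eq.congr_right (tsum_congr fun a => ?_)
  rw [Set.inter_comm, ← Measure.restrict_restrict (measurableSet_admits a),
    ← lintegral_indicator (measurableSet_admits a)]
  refine lintegral_congr fun x => ?_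
  by_cases h : x ∈ admits A a
  · rw [Set.indicator_of_mem h, weight_of_mem h, ENNReal.ofReal_mul (inv_pos.2 hl).le]
  · rw [Set.indicator_of_notMem h, weight_of_notMem h, mul_zero]

theorem concatSeq_singleton (a : ℕ) (u : ℕ → ℕ) : concatSeq [a] u = prependSeq a u := by
  funext i
  cases i <;> simp [concatSeq, prependSeq]

theorem isAdm_prependSeq {a : ℕ} {x : Space A} :
    IsAdm A (prependSeq a x.1) ↔ x ∈ admits A a := by
  refine ⟨fun h => h 0, fun h => ?_⟩
  rw [← prep_val_of_mem h]
  exact (prep A a x).2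

theorem dlrNum_singleton (a : ℕ) (x : Space A) :
    dlrNum A φ [a] x = (weight A φ a (shift x)).toReal := by
  have hc : concatSeq [a] ((shift^[[a].length] x).1) = prependSeq a (shift x).1 :=
    concatSeq_singleton a _
  by_cases h : shift x ∈ admits A a
  · have h' : IsAdm A (concatSeq [a] ((shift^[[a].length] x).1)) := by
      rw [hc]
      exact isAdm_prependSeq.2 h
    rw [weight_of_mem h, ENNReal.toReal_ofReal (Real.exp_pos _).le, dlrNum, dif_pos h']
    have hy : (⟨_, h'⟩ : Space A) = prep A a (shift x) :=
      Subtype.ext (by rw [prep_val_of_mem h]; exact hc)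
    rw [hy]
    simp [birkhoff]
  · have h' : ¬ IsAdm A (concatSeq [a] ((shift^[[a].length] x).1)) := by
      rw [hc]
      exact fun hh => h (isAdm_prependSeq.1 hh)
    rw [weight_of_notMem h, dlrNum, dif_neg h', ENNReal.toReal_zero]

/-- The points with the same image as `x` correspond to the symbols that can precede `σ x`. -/
noncomputable def fiberEquiv (x : Space A) :
    {y : Space A // shift^[1] y = shift^[1] x} ≃ {a : ℕ // shift x ∈ admits A a} where
  toFun y := ⟨y.1.1 0, by
    have h : shift y.1 = shift x := y.2
    rw [← h]
    exact shift_mem_admits y.1⟩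
  invFun a := ⟨prep A a.1 (shift x), shift_prep a.2⟩
  left_inv y := by
    have h : shift y.1 = shift x := y.2
    apply Subtype.ext
    change prep A (y.1.1 0) (shift x) = y.1
    rw [← h, prep_shift]
  right_inv a := by
    apply Subtype.ext
    change (prep A a.1 (shift x)).1 0 = a.1
    rw [prep_val_of_mem a.2]
    rfl

theorem dlrDen_one (x : Space A) : dlrDen A φ 1 x = (ruelleOne A φ (shift x)).toReal := by
  have h : ruelleOne A φ (shift x) = ∑' a, weight A φ a (shift x) := rfl
  rw [h, ENNReal.tsum_toReal_eq fun a => weight_ne_top a _, dlrDen,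
    ← (fiberEquiv x).symm.tsum_eq]
  have h2 : ∀ a : {a : ℕ // shift x ∈ admits A a},
      Real.exp (birkhoff φ 1 ((fiberEquiv x).symm a).1) =
        (weight A φ a.1 (shift x)).toReal := fun a => by
    rw [weight_of_mem a.2, ENNReal.toReal_ofReal (Real.exp_pos _).le]
    have hy : ((fiberEquiv x).symm a).1 = prep A a.1 (shift x) := rfl
    rw [hy]
    simp [birkhoff]
  rw [tsum_congr h2]
  refine (tsum_subtype {a : ℕ | shift x ∈ admits A a}
    fun a => (weight A φ a (shift x)).toReal).trans (tsum_congr fun a => ?_)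
  by_cases ha : shift x ∈ admits A a
  · exact Set.indicator_of_mem (s := {a : ℕ | shift x ∈ admits A a}) ha _
  · rw [Set.indicator_of_notMem (s := {a : ℕ | shift x ∈ admits A a}) ha, weight_of_notMem ha,
      ENNReal.toReal_zero]

theorem ae_ruelleOne_eq_of_conformal (hφ : Measurable φ) {l : ℝ} (hl : 0 < l)
    {ν : Measure (Space A)} [SigmaFinite ν] (hinv : ν.map shift = ν)
    (hc : Conformal A φ l ν) : ∀ᵐ x ∂ν, ruelleOne A φ x = ENNReal.ofReal l := by
  rw [conformal_iff hφ hl] at hc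
  have hmeas : Measurable fun x => ENNReal.ofReal l⁻¹ * ruelleOne A φ x :=
    (Measurable.tsum (measurable_weight hφ)).const_mul _
  have hone : (fun x => ENNReal.ofReal l⁻¹ * ruelleOne A φ x) =ᵐ[ν] fun _ => 1 := by
    refine ae_eq_of_forall_setLIntegral_eq_of_sigmaFinite hmeas measurable_const
      fun B hB _ => ?_
    rw [setLIntegral_one, ← Measure.map_apply measurable_shift hB |>.symm.trans
      (congrArg (· B) hinv), hc _ (measurable_shift hB)]
    calc ∫⁻ x in B, ENNReal.ofReal l⁻¹ * ruelleOne A φ x ∂ν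
        = ∫⁻ x in B, ∑' a, ENNReal.ofReal l⁻¹ * weight A φ a x ∂ν := by
          refine lintegral_congr fun x => ?_
          rw [ENNReal.tsum_mul_left]
          rfl
      _ = ∑' a, ∫⁻ x in B, ENNReal.ofReal l⁻¹ * weight A φ a x ∂ν :=
          lintegral_tsum fun a => ((measurable_weight hφ a).const_mul _).aemeasurable
      _ = _ := by
          refine tsum_congr fun a => ?_
          rw [← lintegral_indicator hB,
            ← lintegral_indicator (measurable_prep a (measurable_shift hB))]
          refine lintegral_congr fun x => ?_
          by_cases h : x ∈ admits A a
          · have hiff : x ∈ prep A a ⁻¹' (shift ⁻¹' B) ↔ x ∈ B := by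
              rw [Set.mem_preimage, Set.mem_preimage, shift_prep h]
            by_cases hx : x ∈ B
            · rw [Set.indicator_of_mem hx, Set.indicator_of_mem (hiff.2 hx)]
            · rw [Set.indicator_of_notMem hx, Set.indicator_of_notMem (mt hiff.1 hx)]
          · simp only [Set.indicator, weight_of_notMem h, mul_zero, ite_self]
  filter_upwards [hone] with x hx
  rw [ENNReal.ofReal_inv_of_pos hl] at hx
  have h0 : ENNReal.ofReal l ≠ 0 := by simpa using hl
  calc ruelleOne A φ x
      = ENNReal.ofReal l * ((ENNReal.ofReal l)⁻¹ * ruelleOne A φ x) := by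
        rw [← mul_assoc, ENNReal.mul_inv_cancel h0 ENNReal.ofReal_ne_top, one_mul]
    _ = ENNReal.ofReal l := by rw [hx, mul_one]

/-- If `L_φ 1` is constant, the one-step conditional probabilities of a `φ`-DLR measure are given
by the normalised weights. -/
theorem IsDLR.condExp_cyl_singleton {l : ℝ} (hl : 0 < l) {ν : Measure (Space A)}
    (hinv : ν.map shift = ν) (hdlr : IsDLR A φ ν)
    (hF : ∀ᵐ x ∂ν, ruelleOne A φ x = ENNReal.ofReal l) (a : ℕ) :
    (ν[(cyl A [a]).indicator (fun _ => (1 : ℝ))|shiftSigma A 1]) =ᵐ[ν]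
      fun x => (ENNReal.ofReal l⁻¹ * weight A φ a (shift x)).toReal := by
  have hF' : ∀ᵐ x ∂ν, ruelleOne A φ (shift x) = ENNReal.ofReal l :=
    ae_of_ae_map measurable_shift.aemeasurable (by rwa [hinv])
  filter_upwards [(hdlr 1 le_rfl).2 [a] rfl, hF'] with x hx hx'
  rw [hx, dlrNum_singleton, dlrDen_one, hx', ENNReal.toReal_ofReal hl.le, ENNReal.toReal_mul,
    ENNReal.toReal_ofReal (inv_pos.2 hl).le, div_eq_inv_mul]

theorem IsDLR.measure_cyl_singleton_ne_top {l : ℝ} (hl : 0 < l)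
    {ν : Measure (Space A)} (hinv : ν.map shift = ν) (hdlr : IsDLR A φ ν)
    (hF : ∀ᵐ x ∂ν, ruelleOne A φ x = ENNReal.ofReal l) (a : ℕ) : ν (cyl A [a]) ≠ ⊤ := by
  intro htop
  have hni : ¬ Integrable ((cyl A [a]).indicator fun _ => (1 : ℝ)) ν := fun h => by
    have := (integrable_indicator_iff (measurableSet_cyl_singleton a)).1 h
    rw [integrableOn_const_iff] at this
    simp [htop] at this
  have hd := hdlr.condExp_cyl_singleton hl hinv hF a
  rw [condExp_of_not_integrable hni] at hd
  have h0 : ν (cyl A [a]) = 0 := by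
    rw [measure_eq_zero_iff_ae_notMem]
    filter_upwards [hd] with x hx hxa
    rw [mem_cyl_singleton] at hxa
    subst hxa
    have hpos : 0 < l⁻¹ * Real.exp (φ (prep A (x.1 0) (shift x))) := by positivity
    rw [weight_of_mem (shift_mem_admits x), ENNReal.toReal_mul,
      ENNReal.toReal_ofReal (Real.exp_pos _).le, ENNReal.toReal_ofReal (inv_pos.2 hl).le] at hx
    exact hpos.ne hx
  simp [htop] at h0

theorem IsDLR.measure_preimage_shift_inter_cyl (hφ : Measurable φ) {l : ℝ} (hl : 0 < l)
    {ν : Measure (Space A)} (hinv : ν.map shift = ν) (hdlr : IsDLR A φ ν)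
    (hF : ∀ᵐ x ∂ν, ruelleOne A φ x = ENNReal.ofReal l) (a : ℕ)
    {B : Set (Space A)} (hB : MeasurableSet B) :
    ν (shift ⁻¹' B ∩ cyl A [a]) = ∫⁻ x in B, ENNReal.ofReal l⁻¹ * weight A φ a x ∂ν := by
  have hfin := hdlr.measure_cyl_singleton_ne_top hl hinv hF a
  have hcyl := measurableSet_cyl_singleton (A := A) a
  have hint : Integrable ((cyl A [a]).indicator fun _ => (1 : ℝ)) ν :=
    (integrable_indicator_iff hcyl).2 (integrableOn_const hfin)
  have hd := hdlr.condExp_cyl_singleton hl hinv hF a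
  have hsf : SigmaFinite (ν.trim (shiftSigma_le (A := A) 1)) :=
    Compatible.sigmaFinite_trim _ (hdlr 1 le_rfl).1
  have hBs : MeasurableSet[shiftSigma A 1] (shift ⁻¹' B) := ⟨B, hB, rfl⟩
  have hS := measurable_shift hB
  have hint' := (integrable_condExp (m := shiftSigma A 1) (μ := ν)
    (f := (cyl A [a]).indicator fun _ => (1 : ℝ))).congr hd
  have h1 := setIntegral_condExp (shiftSigma_le (A := A) 1) hint hBs
  rw [setIntegral_congr_ae hS (hd.mono fun x hx _ => hx), setIntegral_indicator hcyl,
    setIntegral_const, smul_eq_mul, mul_one] at h1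
  have hw : Measurable fun x => ENNReal.ofReal l⁻¹ * weight A φ a x :=
    (measurable_weight hφ a).const_mul _
  have hne : ν (shift ⁻¹' B ∩ cyl A [a]) ≠ ⊤ := measure_ne_top_of_subset Set.inter_subset_right hfin
  rw [← ENNReal.ofReal_toReal hne]
  change ENNReal.ofReal (ν.real _) = _
  rw [← h1, ofReal_integral_eq_lintegral_ofReal hint'.integrableOn
    (Eventually.of_forall fun _ => ENNReal.toReal_nonneg)]
  conv_rhs => rw [← hinv, setLIntegral_map hB hw measurable_shift]
  refine lintegral_congr fun x => ENNReal.ofReal_toReal ?_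
  exact ENNReal.mul_ne_top ENNReal.ofReal_ne_top (weight_ne_top a _)

theorem IsDLR.conformal (hφ : Measurable φ) {l : ℝ} (hl : 0 < l)
    {ν : Measure (Space A)} (hinv : ν.map shift = ν) (hdlr : IsDLR A φ ν)
    (hF : ∀ᵐ x ∂ν, ruelleOne A φ x = ENNReal.ofReal l) : Conformal A φ l ν := by
  rw [conformal_iff hφ hl]
  intro E hE
  have hU : E = ⋃ a, E ∩ cyl A [a] := by
    ext x
    simp [mem_cyl_singleton]
  conv_lhs => rw [hU]
  rw [measure_iUnion]
  · refine tsum_congr fun a => ?_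
    rw [← preimage_shift_preimage_prep_inter_cyl,
      hdlr.measure_preimage_shift_inter_cyl hφ hl hinv hF a (measurable_prep a hE)]
  · intro a b hab
    refine Set.disjoint_left.2 fun x hx hy => hab ?_
    rw [← mem_cyl_singleton.1 hx.2, ← mem_cyl_singleton.1 hy.2]
  · exact fun a => hE.inter (measurableSet_cyl_singleton a)

end Weight

theorem statement8 (A : ℕ → ℕ → Bool) (hA : NoDegenerate A)
    (φ : Space A → ℝ) (hφ : Measurable φ) (l : ℝ) (hl : 0 < l)
    (m : Measure (Space A)) (hsf : SigmaFinite m)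
    (hinv : m.map shift = m) (hdlr : IsDLR A φ m) :
    (∀ᵐ x ∂m, ruelleOne A φ x = ENNReal.ofReal l) ↔ Conformal A φ l m := by
  exact ⟨hdlr.conformal hφ hl hinv, ae_ruelleOne_eq_of_conformal hφ hl hinv⟩

end CMS
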